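/- Let I = [a,b] and let F : I → I be a PM function with forts c_1 < … < c_v (c_0 := a, c_{v+1} := b), v ≥ 3, such that F(I) ⊆ [c_0,c_1] (so H(F) = 1 and the characteristic interval is K(F) = [c_0,c_1]) and F is strictly increasing on [c_0,c_1]. Suppose there is a smallest index u ∈ {4,5,…,v+1} with F(c_u) = c_0, and that F(c_3) = max_{x∈[c_0,c_u]} F(x). Suppose furthermore that one of the following holds: (i) F(c_2) = c_0 = F(c_0), F(c_1) < F(c_3) < c_1 and c_1 = max_{x∈I} F(x); or (ii) c_0 < F(c_2) < F(c_0) and F(c_3) = c_1 = F(c_1); or (iii) c_0 < F(c_2) < F(c_0) and F(c_1) < F(c_3) < c_1. Then F has a continuous iterative root f of order 2 (i.e., f : I → I continuous with f∘f = F) such that f is strictly increasing on [c_0,c_1] and H(f) = 2. -/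

import Mathlib

open Set Function

noncomputable section

/-- `x` is a fort of `F` on `[a,b]`: `F` is not strictly monotone on any
neighborhood of `x` in `[a,b]`. -/
def IsFort (a b : ℝ) (F : ℝ → ℝ) (x : ℝ) : Prop :=
  x ∈ Set.Icc a b ∧ ∀ ε : ℝ, 0 < ε →
    ¬ StrictMonoOn F (Set.Icc a b ∩ Set.Ioo (x - ε) (x + ε)) ∧
    ¬ StrictAntiOn F (Set.Icc a b ∩ Set.Ioo (x - ε) (x + ε))

/-- The number of forts `N(F)` of `F` on `[a,b]`. -/
noncomputable def nForts (a b : ℝ) (F : ℝ → ℝ) : ℕ :=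
  {x | IsFort a b F x}.ncard

/-- `H(F) = m`: the nonmonotonicity height of `F` on `[a,b]` equals `m`, i.e. `m` is
the least `i ≥ 0` with `N(F^i) = N(F^{i+1})`. -/
def HeightEq (a b : ℝ) (F : ℝ → ℝ) (m : ℕ) : Prop :=
  IsLeast {i : ℕ | nForts a b (F^[i]) = nForts a b (F^[i + 1])} m

/-- `F` is a PM function on `[a,b]` with forts `c 1 < ... < c v`
(`c 0 = a`, `c (v+1) = b`): `F` is continuous, maps `[a,b]` into itself,
is strictly monotone on each lap `[c i, c (i+1)]`, and each `c i`, `1 ≤ i ≤ v`,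
is a fort. -/
structure PMFun (a b : ℝ) (F : ℝ → ℝ) (v : ℕ) (c : ℕ → ℝ) : Prop where
  lt : a < b
  cont : ContinuousOn F (Set.Icc a b)
  maps : Set.MapsTo F (Set.Icc a b) (Set.Icc a b)
  c_zero : c 0 = a
  c_last : c (v + 1) = b
  c_mono : ∀ i ≤ v, c i < c (i + 1)
  lap_mono : ∀ i ≤ v,
    StrictMonoOn F (Set.Icc (c i) (c (i + 1))) ∨ StrictAntiOn F (Set.Icc (c i) (c (i + 1)))
  fort : ∀ i, 1 ≤ i → i ≤ v → IsFort a b F (c i)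

/-- `[d,e]` is a lap of `G` on `[a,b]`: a maximal interval of strict monotonicity,
bounded by forts or the endpoints of `[a,b]`, with no fort inside. -/
def IsLap (a b : ℝ) (G : ℝ → ℝ) (d e : ℝ) : Prop :=
  a ≤ d ∧ d < e ∧ e ≤ b ∧
  (StrictMonoOn G (Set.Icc d e) ∨ StrictAntiOn G (Set.Icc d e)) ∧
  (d = a ∨ IsFort a b G d) ∧ (e = b ∨ IsFort a b G e) ∧
  ∀ x ∈ Set.Ioo d e, ¬ IsFort a b G x

/-- The set of fixed points of `φ` in `[α,β]`. -/
def fixedSet (α β : ℝ) (φ : ℝ → ℝ) : Set ℝ := {x | x ∈ Set.Icc α β ∧ φ x = x}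

/-- `φ` is a reversing-correspondence on `[α,β]`. -/
def RevCorr (α β : ℝ) (φ : ℝ → ℝ) : Prop :=
  StrictMonoOn φ (Set.Icc α β) ∧ ContinuousOn φ (Set.Icc α β) ∧
  Set.MapsTo φ (Set.Icc α β) (Set.Icc α β) ∧
  ∃ ξ ∈ fixedSet α β φ, ∃ ω : ℝ → ℝ,
    Set.MapsTo ω (fixedSet α β φ) (fixedSet α β φ) ∧
    StrictAntiOn ω (fixedSet α β φ) ∧
    Set.SurjOn ω (fixedSet α β φ) (fixedSet α β φ) ∧
    ω ξ = ξ ∧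
    ((α ∈ fixedSet α β φ ∧ β ∈ fixedSet α β φ) ∨
      (α ∉ fixedSet α β φ ∧ β ∉ fixedSet α β φ)) ∧
    (∀ ξ₁ ∈ fixedSet α β φ, ∀ ξ₂ ∈ fixedSet α β φ, ξ₁ < ξ₂ → ξ₂ ≤ ξ →
      (∀ z ∈ Set.Ioo ξ₁ ξ₂, z ∉ fixedSet α β φ) →
      ∀ x ∈ Set.Ioo ξ₁ ξ₂, ∀ y ∈ Set.Ioo (ω ξ₂) (ω ξ₁),
        (φ x - x) * (φ y - y) < 0)

section SquareRoots

/-- A continuous strictly increasing function on a compact interval extends to an order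
automorphism of `ℝ`. -/
theorem exists_orderIso_eqOn_Icc {p q : ℝ} (hpq : p ≤ q) {g : ℝ → ℝ}
    (hg : StrictMonoOn g (Icc p q)) (hc : ContinuousOn g (Icc p q)) :
    ∃ Φ : ℝ ≃o ℝ, ∀ x ∈ Icc p q, Φ x = g x := by
  have hproj : ∀ x, max p (min q x) ∈ Icc p q := fun x =>
    ⟨le_max_left _ _, max_le hpq (min_le_left _ _)⟩
  let G : ℝ → ℝ := fun x => g (max p (min q x)) + (x - max p (min q x))
  have hGc : Continuous G := by
    have : Continuous fun x => g (max p (min q x)) :=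
      hc.comp_continuous (by fun_prop) hproj
    exact this.add (by fun_prop)
  have hGm : StrictMono G := by
    intro x y hxy
    have h1 : max p (min q x) ≤ max p (min q y) :=
      max_le_max le_rfl (min_le_min le_rfl hxy.le)
    have h3 : x - max p (min q x) ≤ y - max p (min q y) := by
      rcases max_cases p (min q x) with h | h <;> rcases max_cases p (min q y) with h' | h' <;>
      rcases min_cases q x with k | k <;> rcases min_cases q y with k' | k' <;> linarith
    rcases h1.eq_or_lt with h | h
    · change g _ + _ < g _ + _
      rw [h]
      linarith
    · exact add_lt_add_of_lt_of_le (hg (hproj x) (hproj y) h) h3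
  have hb : ∀ x, g p - q ≤ G x - x ∧ G x - x ≤ g q - p := by
    intro x
    have h1 := hg.monotoneOn (left_mem_Icc.2 hpq) (hproj x) (hproj x).1
    have h2 := hg.monotoneOn (hproj x) (right_mem_Icc.2 hpq) (hproj x).2
    have h3 := (hproj x).1
    have h4 := (hproj x).2
    simp only [G]
    constructor <;> linarith
  have hs : Surjective G := by
    refine hGc.surjective ?_ ?_
    · refine Filter.tendsto_atTop_mono (f := fun x => x + (g p - q)) (fun x => ?_)
        (Filter.tendsto_atTop_add_const_right _ _ Filter.tendsto_id)
      linarith [(hb x).1]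
    · refine Filter.tendsto_atBot_mono (f := fun x => x + (g q - p)) (fun x => ?_)
        (Filter.tendsto_atBot_add_const_right _ _ Filter.tendsto_id)
      linarith [(hb x).2]
  refine ⟨hGm.orderIsoOfSurjective G hs, fun x hx => ?_⟩
  simp [G, hx.1, hx.2]

/-- `y` lies in the convex hull of the orbit of `x` under `Φ`. -/
def OrbitRel (Φ : ℝ ≃o ℝ) (x y : ℝ) : Prop :=
  ∃ i j : ℤ, (Φ ^ i) x ≤ y ∧ y ≤ (Φ ^ j) x

theorem zpow_add_apply (Φ : ℝ ≃o ℝ) (i j : ℤ) (x : ℝ) :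
    (Φ ^ (i + j)) x = (Φ ^ i) ((Φ ^ j) x) := by
  rw [zpow_add]; rfl

theorem zpow_add_one_apply (Φ : ℝ ≃o ℝ) (i : ℤ) (x : ℝ) :
    (Φ ^ (i + 1)) x = (Φ ^ i) (Φ x) := by
  rw [zpow_add_apply, zpow_one]

theorem zpow_one_add_apply (Φ : ℝ ≃o ℝ) (i : ℤ) (x : ℝ) :
    (Φ ^ (i + 1)) x = Φ ((Φ ^ i) x) := by
  rw [add_comm, zpow_add_apply, zpow_one]

theorem zpow_neg_apply_le_iff (Φ : ℝ ≃o ℝ) (i : ℤ) (x y : ℝ) :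
    (Φ ^ (-i)) x ≤ y ↔ x ≤ (Φ ^ i) y := by
  rw [← (Φ ^ i).le_iff_le, ← zpow_add_apply]
  simp

theorem le_zpow_neg_apply_iff (Φ : ℝ ≃o ℝ) (i : ℤ) (x y : ℝ) :
    y ≤ (Φ ^ (-i)) x ↔ (Φ ^ i) y ≤ x := by
  rw [← (Φ ^ i).le_iff_le, ← zpow_add_apply]
  simp

theorem zpow_apply_eq_self {Φ : ℝ ≃o ℝ} {x : ℝ} (h : Φ x = x) (i : ℤ) : (Φ ^ i) x = x := by
  induction i with
  | zero => simp
  | succ n ih => rw [zpow_add_one_apply, h, ih]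
  | pred n ih =>
    rw [← Φ.injective.eq_iff, ← zpow_one_add_apply, h]
    simpa using ih

namespace OrbitRel

variable {Φ : ℝ ≃o ℝ} {x y z : ℝ}

theorem refl (Φ : ℝ ≃o ℝ) (x : ℝ) : OrbitRel Φ x x := ⟨0, 0, by simp⟩

theorem symm (h : OrbitRel Φ x y) : OrbitRel Φ y x := by
  obtain ⟨i, j, hi, hj⟩ := h
  exact ⟨-j, -i, (zpow_neg_apply_le_iff ..).2 hj, (le_zpow_neg_apply_iff ..).2 hi⟩

theorem trans (h : OrbitRel Φ x y) (h' : OrbitRel Φ y z) : OrbitRel Φ x z := by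
  obtain ⟨i, j, hi, hj⟩ := h
  obtain ⟨k, l, hk, hl⟩ := h'
  refine ⟨k + i, l + j, ?_, ?_⟩ <;> rw [zpow_add_apply]
  · exact ((Φ ^ k).monotone hi).trans hk
  · exact hl.trans ((Φ ^ l).monotone hj)

theorem of_lt_of_le {x' y' : ℝ} (hx : OrbitRel Φ x x') (hy : OrbitRel Φ y y') (hxy : x < y)
    (hyx : y' ≤ x') : OrbitRel Φ x y := by
  obtain ⟨-, j, -, hj⟩ := hx
  obtain ⟨-, l, -, hl⟩ := hy.symm
  refine ⟨0, l + j, by simpa using hxy.le, ?_⟩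
  rw [zpow_add_apply]
  exact hl.trans ((Φ ^ l).monotone (hyx.trans hj))

theorem eq_of_fixed (h : OrbitRel Φ x y) (hx : Φ x = x) : y = x := by
  obtain ⟨i, j, hi, hj⟩ := h
  rw [zpow_apply_eq_self hx] at hi hj
  exact le_antisymm hj hi

/-- A fixed point separates the orbit classes on its two sides. -/
theorem not_of_fixed_between {p : ℝ} (hp : Φ p = p) (hxp : x ≤ p) (hpy : p ≤ y) (hxy : x < y) :
    ¬ OrbitRel Φ x y := by
  intro h
  have hpx : OrbitRel Φ p y := by
    obtain ⟨i, j, hi, hj⟩ := h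
    refine ⟨0, j, by simpa using hpy, hj.trans ((Φ ^ j).monotone hxp)⟩
  have hyp := hpx.eq_of_fixed hp
  subst hyp
  exact hxy.ne (h.symm.eq_of_fixed hp)

theorem inv_apply_iff : OrbitRel Φ⁻¹ (Φ x) y ↔ OrbitRel Φ x y := by
  have key : ∀ i : ℤ, (Φ⁻¹ ^ i) (Φ x) = (Φ ^ (-i + 1)) x := fun i => by
    rw [inv_zpow', zpow_add_one_apply]
  constructor
  · rintro ⟨i, j, hi, hj⟩
    rw [key] at hi hj
    exact ⟨_, _, hi, hj⟩
  · rintro ⟨i, j, hi, hj⟩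
    refine ⟨-i + 1, -j + 1, ?_, ?_⟩ <;> rw [key]
    · convert hi using 3; ring
    · convert hj using 3; ring

end OrbitRel

/-- On an orbit class where `Φ` moves points up, `Φ` is conjugate to the unit translation. -/
theorem exists_conj_translation (Φ : ℝ ≃o ℝ) {m m' : ℝ} (h1 : m < m') (h2 : m' < Φ m) :
    ∃ E : ℝ → ℝ, StrictMono E ∧ (∀ t, E (t + 1) = Φ (E t)) ∧ E 0 = m ∧ E (1 / 2) = m' ∧
      ∀ x, x ∈ range E ↔ OrbitRel Φ m x := by
  let g : ℝ → ℝ := fun t =>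
    if t ≤ 1 / 2 then m + 2 * t * (m' - m) else m' + (2 * t - 1) * (Φ m - m')
  have hg : StrictMono g := by
    intro s t hst
    simp only [g]
    split_ifs with hs ht ht
    · nlinarith
    · nlinarith
    · linarith
    · nlinarith
  have g0 : g 0 = m := by simp [g]
  have gh : g (1 / 2) = m' := by simp [g]
  have g1 : g 1 = Φ m := by norm_num [g]
  have gc : Continuous g := by
    refine Continuous.if_le (by fun_prop) (by fun_prop) (by fun_prop) (by fun_prop) ?_
    rintro t rfl
    ring
  let E : ℝ → ℝ := fun t => (Φ ^ ⌊t⌋) (g (Int.fract t))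
  have lower : ∀ t, (Φ ^ ⌊t⌋) m ≤ E t := fun t =>
    (Φ ^ ⌊t⌋).monotone (g0 ▸ hg.monotone (Int.fract_nonneg t))
  have upper : ∀ t, E t < (Φ ^ (⌊t⌋ + 1)) m := fun t => by
    rw [zpow_add_one_apply]
    exact (Φ ^ ⌊t⌋).strictMono (g1 ▸ hg (Int.fract_lt_one t))
  have hpow : StrictMono fun n : ℤ => (Φ ^ n) m := by
    refine strictMono_int_of_lt_succ fun n => ?_
    rw [zpow_add_one_apply]
    exact (Φ ^ n).strictMono (h1.trans h2)
  refine ⟨E, ?_, ?_, ?_, ?_, ?_⟩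
  · intro s t hst
    rcases (Int.floor_mono hst.le).eq_or_lt with h | h
    · simp only [E, h]
      refine (Φ ^ ⌊t⌋).strictMono (hg ?_)
      rw [Int.fract, Int.fract, h]
      linarith
    · exact (upper s).trans_le ((hpow.monotone (Int.add_one_le_iff.2 h)).trans (lower t))
  · intro t
    simp only [E, Int.floor_add_one, Int.fract_add_one, zpow_one_add_apply]
  · simp [E, g0]
  · have : ⌊(1 / 2 : ℝ)⌋ = 0 := by rw [Int.floor_eq_iff]; norm_num
    have h' : Int.fract (1 / 2 : ℝ) = 1 / 2 := by rw [Int.fract, this]; simp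
    simp only [E, this, h', gh]
    simp
  · intro x
    constructor
    · rintro ⟨t, rfl⟩
      exact ⟨_, _, lower t, (upper t).le⟩
    · rintro ⟨i, j, hi, hj⟩
      obtain ⟨n, hn, hmax⟩ := Int.exists_greatest_of_bdd (P := fun n => (Φ ^ n) m ≤ x)
        ⟨j, fun n hn => hpow.le_iff_le.1 (hn.trans hj)⟩ ⟨i, hi⟩
      have hn' : x < (Φ ^ (n + 1)) m := by
        by_contra! h
        have := hmax _ h
        omega
      set y := (Φ ^ n).symm x with hy
      have hxy : (Φ ^ n) y = x := by simp [hy]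
      rw [← hxy] at hn hn'
      rw [zpow_add_one_apply, (Φ ^ n).lt_iff_lt] at hn'
      rw [(Φ ^ n).le_iff_le] at hn
      obtain ⟨t, ht, hty⟩ : y ∈ g '' Ico 0 1 :=
        intermediate_value_Ico zero_le_one gc.continuousOn (by rw [g0, g1]; exact ⟨hn, hn'⟩)
      refine ⟨n + t, ?_⟩
      have hf : ⌊t⌋ = 0 := Int.floor_eq_zero_iff.2 ht
      have hfr : Int.fract t = t := Int.fract_eq_self.2 ht
      simp only [E, Int.floor_intCast_add, Int.fract_intCast_add, hf, hfr, add_zero, hty, hxy]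

/-- A square root of `Φ` on the orbit class of `m`, with prescribed value at `m`. -/
theorem exists_sqrt_on_orbit (Φ : ℝ ≃o ℝ) {m m' : ℝ}
    (h : (m < m' ∧ m' < Φ m) ∨ (Φ m < m' ∧ m' < m) ∨ (m' = m ∧ Φ m = m)) :
    ∃ ψ : ℝ → ℝ, (∀ x, OrbitRel Φ m x → OrbitRel Φ m (ψ x)) ∧
      StrictMonoOn ψ {x | OrbitRel Φ m x} ∧
      (∀ x, OrbitRel Φ m x → ψ (ψ x) = Φ x) ∧ ψ m = m' := by
  have main : ∀ (E : ℝ → ℝ) (s t₀ : ℝ), StrictMono E → (∀ t, E (t + s + s) = Φ (E t)) →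
      E t₀ = m → E (t₀ + s) = m' → (∀ x, x ∈ range E ↔ OrbitRel Φ m x) →
      ∃ ψ : ℝ → ℝ, (∀ x, OrbitRel Φ m x → OrbitRel Φ m (ψ x)) ∧
        StrictMonoOn ψ {x | OrbitRel Φ m x} ∧
        (∀ x, OrbitRel Φ m x → ψ (ψ x) = Φ x) ∧ ψ m = m' := by
    intro E s t₀ hE hs h0 h1 hr
    have hinv : ∀ t, invFun E (E t) = t := leftInverse_invFun hE.injective
    refine ⟨fun x => E (invFun E x + s), fun x _ => (hr _).1 ⟨_, rfl⟩, ?_, ?_, ?_⟩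
    · intro x hx y hy hxy
      obtain ⟨t, rfl⟩ := (hr x).2 hx
      obtain ⟨t', rfl⟩ := (hr y).2 hy
      simp only [hinv]
      exact hE (by linarith [hE.lt_iff_lt.1 hxy])
    · intro x hx
      obtain ⟨t, rfl⟩ := (hr x).2 hx
      simp only [hinv, hs]
    · simp only [← h0, hinv, h1]
  rcases h with ⟨h1, h2⟩ | ⟨h1, h2⟩ | ⟨h1, h2⟩
  · obtain ⟨E, hE, hs, h0, hh, hr⟩ := exists_conj_translation Φ h1 h2
    refine main E (1 / 2) 0 hE (fun t => ?_) h0 (by simpa using hh) hr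
    rw [← hs]
    ring_nf
  · have hinv : Φ⁻¹ (Φ m) = m := Φ.symm_apply_apply m
    obtain ⟨E, hE, hs, h0, hh, hr⟩ := exists_conj_translation Φ⁻¹ h1 (hinv.symm ▸ h2)
    refine main E (-(1 / 2)) 1 hE (fun t => ?_) ?_ ?_ fun x => (hr x).trans OrbitRel.inv_apply_iff
    · have : E t = Φ⁻¹ (E (t + -(1 / 2) + -(1 / 2))) := by
        rw [← hs]
        ring_nf
      rw [this]
      exact (Φ.apply_symm_apply _).symm
    · rw [← zero_add (1 : ℝ), hs, h0, hinv]
    · rw [← hh]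
      norm_num
  · have hfix : ∀ x, OrbitRel Φ m x → x = m := fun x hx => hx.eq_of_fixed h2
    refine ⟨id, fun x hx => hx, strictMono_id.strictMonoOn _, fun x hx => ?_, h1.symm⟩
    rw [hfix x hx, h2]
    rfl

/-- An order automorphism of `ℝ` has an increasing square root, whose values may be prescribed on
a set meeting every orbit class at most once. -/
theorem exists_orderIso_sqrt (Φ : ℝ ≃o ℝ) (T : Set ℝ) (τ : ℝ → ℝ)
    (hT : ∀ x ∈ T, ∀ y ∈ T, OrbitRel Φ x y → x = y)
    (hτ : ∀ x ∈ T, (x < τ x ∧ τ x < Φ x) ∨ (Φ x < τ x ∧ τ x < x) ∨ (τ x = x ∧ Φ x = x)) :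
    ∃ Ψ : ℝ ≃o ℝ, (∀ x, Ψ (Ψ x) = Φ x) ∧ ∀ x ∈ T, Ψ x = τ x := by
  let S : Setoid ℝ := ⟨OrbitRel Φ, OrbitRel.refl Φ, OrbitRel.symm, OrbitRel.trans⟩
  have key : ∀ q : Quotient S, ∃ ψ : ℝ → ℝ,
      (∀ x, Quotient.mk S x = q → Quotient.mk S (ψ x) = q) ∧
      StrictMonoOn ψ {x | Quotient.mk S x = q} ∧
      (∀ x, Quotient.mk S x = q → ψ (ψ x) = Φ x) ∧
      ∀ x ∈ T, Quotient.mk S x = q → ψ x = τ x := by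
    intro q
    obtain ⟨m, m', hm, hmm', hmT⟩ : ∃ m m', Quotient.mk S m = q ∧
        ((m < m' ∧ m' < Φ m) ∨ (Φ m < m' ∧ m' < m) ∨ (m' = m ∧ Φ m = m)) ∧
        ∀ x ∈ T, Quotient.mk S x = q → x = m ∧ τ x = m' := by
      by_cases h : ∃ t ∈ T, Quotient.mk S t = q
      · obtain ⟨t, ht, htq⟩ := h
        refine ⟨t, τ t, htq, hτ t ht, fun x hx hxq => ?_⟩
        have : x = t := hT x hx t ht (Quotient.exact (hxq.trans htq.symm))
        exact ⟨this, congrArg τ this⟩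
      · push Not at h
        refine ⟨q.out, (q.out + Φ q.out) / 2, q.out_eq, ?_, fun x hx hxq => (h x hx hxq).elim⟩
        rcases lt_trichotomy q.out (Φ q.out) with h | h | h
        · left; constructor <;> linarith
        · right; right; constructor <;> linarith
        · right; left; constructor <;> linarith
    obtain ⟨ψ, h1, h2, h3, h4⟩ := exists_sqrt_on_orbit Φ hmm'
    have hq : ∀ x, Quotient.mk S x = q ↔ OrbitRel Φ m x := fun x => by
      rw [← hm, eq_comm]
      exact Quotient.eq (r := S)
    simp only [hq]
    refine ⟨ψ, h1, h2, h3, fun x hx hxq => ?_⟩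
    obtain ⟨rfl, hx'⟩ := hmT x hx ((hq x).2 hxq)
    rw [h4, hx']
  choose ψ h1 h2 h3 h4 using key
  let Ψ : ℝ → ℝ := fun x => ψ (Quotient.mk S x) x
  have hcls : ∀ x, Quotient.mk S (Ψ x) = Quotient.mk S x := fun x => h1 _ x rfl
  have hsq : ∀ x, Ψ (Ψ x) = Φ x := fun x => by
    simp only [Ψ]
    rw [h1 _ x rfl, h3 _ x rfl]
  have hmono : StrictMono Ψ := by
    intro x y hxy
    by_cases h : Quotient.mk S x = Quotient.mk S y
    · have := h2 (Quotient.mk S x) rfl h.symm hxy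
      simpa only [Ψ, ← h] using this
    · by_contra! hle
      have hx : OrbitRel Φ x (Ψ x) := Quotient.exact (hcls x).symm
      have hy : OrbitRel Φ y (Ψ y) := Quotient.exact (hcls y).symm
      exact h (Quotient.sound (hx.of_lt_of_le hy hxy hle))
  have hsurj : Surjective Ψ := fun y => ⟨Ψ (Φ.symm y), by rw [hsq, Φ.apply_symm_apply]⟩
  exact ⟨hmono.orderIsoOfSurjective Ψ hsurj, hsq, fun x hx => h4 _ x hx rfl⟩

end SquareRoots

section Forts

variable {a b : ℝ} {F G : ℝ → ℝ}

theorem not_isFort_of_Icc {x p q : ℝ} (hpx : p < x) (hxq : x < q)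
    (h : StrictMonoOn F (Icc p q) ∨ StrictAntiOn F (Icc p q)) : ¬ IsFort a b F x := by
  rintro ⟨-, hx⟩
  have hε : 0 < min (x - p) (q - x) := lt_min (sub_pos.2 hpx) (sub_pos.2 hxq)
  have hsub : Icc a b ∩ Ioo (x - min (x - p) (q - x)) (x + min (x - p) (q - x)) ⊆ Icc p q := by
    rintro y ⟨-, hy1, hy2⟩
    have := min_le_left (x - p) (q - x)
    have := min_le_right (x - p) (q - x)
    constructor <;> linarith
  rcases h with h | h
  · exact (hx _ hε).1 (h.mono hsub)
  · exact (hx _ hε).2 (h.mono hsub)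

theorem isFort_of_mono_anti {x p q : ℝ} (hap : a ≤ p) (hpx : p < x) (hxq : x < q) (hqb : q ≤ b)
    (h1 : StrictMonoOn F (Icc p x)) (h2 : StrictAntiOn F (Icc x q)) : IsFort a b F x := by
  refine ⟨⟨by linarith, by linarith⟩, fun ε hε => ?_⟩
  have hx : x ∈ Icc a b ∩ Ioo (x - ε) (x + ε) := by
    refine ⟨⟨?_, ?_⟩, ?_, ?_⟩ <;> linarith
  constructor
  · intro h
    obtain ⟨y, hy1, hy2⟩ := exists_between (lt_min hxq (show x < x + ε by linarith))
    have hyq := hy2.trans_le (min_le_left _ _)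
    have hye := hy2.trans_le (min_le_right _ _)
    have hy : y ∈ Icc a b ∩ Ioo (x - ε) (x + ε) := by
      refine ⟨⟨?_, ?_⟩, ?_, ?_⟩ <;> linarith
    exact lt_asymm (h hx hy hy1) (h2 ⟨le_rfl, hxq.le⟩ ⟨hy1.le, hyq.le⟩ hy1)
  · intro h
    obtain ⟨y, hy2, hy1⟩ := exists_between (max_lt hpx (show x - ε < x by linarith))
    have hyq := (le_max_left _ _).trans_lt hy2
    have hye := (le_max_right _ _).trans_lt hy2
    have hy : y ∈ Icc a b ∩ Ioo (x - ε) (x + ε) := by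
      refine ⟨⟨?_, ?_⟩, ?_, ?_⟩ <;> linarith
    exact lt_asymm (h hy hx hy1) (h1 ⟨hyq.le, hy1.le⟩ ⟨hpx.le, le_rfl⟩ hy1)

theorem not_isFort_id (x : ℝ) : ¬ IsFort a b id x :=
  not_isFort_of_Icc (sub_one_lt x) (lt_add_one x) (.inl (strictMono_id.strictMonoOn _))

theorem IsFort.congr {x : ℝ} (h : EqOn F G (Icc a b)) (hx : IsFort a b F x) : IsFort a b G x :=
  ⟨hx.1, fun ε hε =>
    ⟨fun hm => (hx.2 ε hε).1 (hm.congr (h.symm.mono inter_subset_left)),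
      fun hm => (hx.2 ε hε).2 (hm.congr (h.symm.mono inter_subset_left))⟩⟩

theorem nForts_congr (h : EqOn F G (Icc a b)) : nForts a b F = nForts a b G := by
  unfold nForts
  congr 1
  ext x
  exact ⟨fun hx => hx.congr h, fun hx => hx.congr h.symm⟩

theorem nForts_comp_of_strictMonoOn {f : ℝ → ℝ} {K : Set ℝ} (hf : StrictMonoOn f K)
    (hF : MapsTo F (Icc a b) K) : nForts a b (f ∘ F) = nForts a b F := by
  unfold nForts
  congr 1
  ext x
  refine and_congr_right fun _ => forall₂_congr fun ε _ => ?_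
  refine and_congr (not_congr ?_) (not_congr ?_)
  · exact ⟨fun h y hy z hz hyz => (hf.lt_iff_lt (hF hy.1) (hF hz.1)).1 (h hy hz hyz),
      fun h y hy z hz hyz => hf (hF hy.1) (hF hz.1) (h hy hz hyz)⟩
  · exact ⟨fun h y hy z hz hyz => (hf.lt_iff_lt (hF hz.1) (hF hy.1)).1 (h hy hz hyz),
      fun h y hy z hz hyz => hf (hF hz.1) (hF hy.1) (h hy hz hyz)⟩

/-- A fort of a continuous inner function is a fort of the composition. -/
theorem IsFort.of_comp {f g : ℝ → ℝ} (hf : ContinuousOn f (Icc a b))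
    (h : ∀ x ∈ Icc a b, g (f x) = F x) {x : ℝ} (hx : IsFort a b f x) : IsFort a b F x := by
  by_contra hF
  have hinj : ∃ ε > 0, InjOn F (Icc a b ∩ Ioo (x - ε) (x + ε)) := by
    simp only [IsFort, hx.1, true_and] at hF
    push Not at hF
    obtain ⟨ε, hε, h'⟩ := hF
    refine ⟨ε, hε, ?_⟩
    by_cases hm : StrictMonoOn F (Icc a b ∩ Ioo (x - ε) (x + ε))
    · exact hm.injOn
    · exact (h' hm).injOn
  obtain ⟨ε, hε, hinj⟩ := hinj
  have hle : max a (x - ε / 2) ≤ min b (x + ε / 2) :=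
    max_le (le_min (hx.1.1.trans hx.1.2) (by linarith [hx.1.1]))
      (le_min (by linarith [hx.1.2]) (by linarith))
  have hsub : Icc (max a (x - ε / 2)) (min b (x + ε / 2)) ⊆ Icc a b ∩ Ioo (x - ε) (x + ε) := by
    rintro y ⟨hy1, hy2⟩
    rw [max_le_iff] at hy1
    rw [le_min_iff] at hy2
    exact ⟨⟨hy1.1, hy2.1⟩, by linarith, by linarith⟩
  have hfinj : InjOn f (Icc (max a (x - ε / 2)) (min b (x + ε / 2))) := by
    intro y hy z hz hyz
    refine hinj (hsub hy) (hsub hz) ?_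
    rw [← h y (hsub hy).1, ← h z (hsub hz).1, hyz]
  have hsup : Icc a b ∩ Ioo (x - ε / 2) (x + ε / 2) ⊆
      Icc (max a (x - ε / 2)) (min b (x + ε / 2)) := fun y hy =>
    ⟨max_le hy.1.1 hy.2.1.le, le_min hy.1.2 hy.2.2.le⟩
  rcases (hf.mono fun y hy => (hsub hy).1).strictMonoOn_of_injOn_Icc' hle hfinj with h' | h'
  · exact (hx.2 _ (half_pos hε)).1 (h'.mono hsup)
  · exact (hx.2 _ (half_pos hε)).2 (h'.mono hsup)

namespace PMFun

variable {v : ℕ} {c : ℕ → ℝ}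

theorem c_le (h : PMFun a b F v c) {i j : ℕ} (hij : i ≤ j) (hj : j ≤ v + 1) : c i ≤ c j := by
  induction j, hij using Nat.le_induction with
  | base => exact le_rfl
  | succ n _ ih => exact (ih (by omega)).trans (h.c_mono n (by omega)).le

theorem finite_forts (h : PMFun a b F v c) : {x | IsFort a b F x}.Finite := by
  refine ((Finset.range (v + 2)).image c).finite_toSet.subset fun x hx => ?_
  simp only [Finset.coe_image, Finset.coe_range]
  by_contra hxc
  have hne : ∀ i ≤ v + 1, c i ≠ x := fun i hi hix => hxc ⟨i, by simp; omega, hix⟩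
  have hlt : ∀ i ≤ v + 1, c i < x := by
    intro i
    induction i with
    | zero => exact fun hi => lt_of_le_of_ne (h.c_zero ▸ hx.1.1) (hne 0 hi)
    | succ n ih =>
      intro hn
      by_contra! hle
      exact not_isFort_of_Icc (ih (by omega)) (lt_of_le_of_ne hle (hne _ hn).symm)
        (h.lap_mono n (by omega)) hx
  have := hlt (v + 1) le_rfl
  rw [h.c_last] at this
  exact this.not_ge hx.1.2

theorem anti_of_mono (h : PMFun a b F v c) {i : ℕ} (hi : i < v)
    (hm : StrictMonoOn F (Icc (c i) (c (i + 1)))) :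
    StrictAntiOn F (Icc (c (i + 1)) (c (i + 2))) := by
  have h1 := h.c_mono i hi.le
  have h2 := h.c_mono (i + 1) hi
  refine (h.lap_mono (i + 1) hi).resolve_left fun hm' => ?_
  refine not_isFort_of_Icc h1 h2 (.inl ?_) (h.fort (i + 1) (by omega) hi)
  rw [← Icc_union_Icc_eq_Icc h1.le h2.le]
  exact hm.union hm' (isGreatest_Icc h1.le) (isLeast_Icc h2.le)

theorem mono_of_anti (h : PMFun a b F v c) {i : ℕ} (hi : i < v)
    (hm : StrictAntiOn F (Icc (c i) (c (i + 1)))) :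
    StrictMonoOn F (Icc (c (i + 1)) (c (i + 2))) := by
  have h1 := h.c_mono i hi.le
  have h2 := h.c_mono (i + 1) hi
  refine (h.lap_mono (i + 1) hi).resolve_right fun hm' => ?_
  refine not_isFort_of_Icc h1 h2 (.inr ?_) (h.fort (i + 1) (by omega) hi)
  rw [← Icc_union_Icc_eq_Icc h1.le h2.le]
  exact hm.union hm' (isGreatest_Icc h1.le) (isLeast_Icc h2.le)

end PMFun

end Forts

/-- A square root with a fort, and with strictly fewer forts than its square, which is strictly
monotone on the range of the square, has height two. -/
theorem heightEq_two_of_sq {a b : ℝ} {F f : ℝ → ℝ} {K : Set ℝ} (hf : ContinuousOn f (Icc a b))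
    (hsq : ∀ x ∈ Icc a b, f (f x) = F x) (hfin : {x | IsFort a b F x}.Finite)
    (hK : MapsTo F (Icc a b) K) (hfK : StrictMonoOn f K)
    (hne : ∃ x, IsFort a b f x) (hlt : ∃ x, IsFort a b F x ∧ ¬ IsFort a b f x) :
    HeightEq a b f 2 := by
  have hsub : {x | IsFort a b f x} ⊆ {x | IsFort a b F x} := fun x hx => hx.of_comp hf hsq
  have h0 : nForts a b f^[0] = 0 := by
    rw [nForts, show {x | IsFort a b f^[0] x} = ∅ from
      eq_empty_of_forall_notMem fun x hx => not_isFort_id x hx, ncard_empty]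
  have h1 : nForts a b f^[1] ≠ 0 := by
    obtain ⟨x, hx⟩ := hne
    exact Set.ncard_ne_zero_of_mem hx (hfin.subset hsub)
  have h2 : nForts a b f^[2] = nForts a b F := nForts_congr hsq
  have h3 : nForts a b f^[3] = nForts a b F := by
    rw [← nForts_comp_of_strictMonoOn hfK hK]
    exact nForts_congr fun x hx => congrArg f (hsq x hx)
  have h12 : nForts a b f^[1] < nForts a b f^[2] := by
    rw [h2, iterate_one]
    obtain ⟨x, hx, hx'⟩ := hlt
    exact Set.ncard_lt_ncard ⟨hsub, fun h => hx' (h hx)⟩ hfin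
  refine ⟨h2.trans h3.symm, fun i hi => ?_⟩
  by_contra! hi2
  interval_cases i
  · exact h1 (hi.symm.trans h0)
  · exact h12.ne hi

/-- An increasing square root of an increasing self-map of `[α, β]`, with prescribed values at the
two endpoints. -/
theorem exists_sqrt_Icc_of_endpoints {F : ℝ → ℝ} {α β α' β' : ℝ} (hαβ : α < β)
    (hF : StrictMonoOn F (Icc α β)) (hFc : ContinuousOn F (Icc α β))
    (hα : (α < α' ∧ α' < F α) ∨ (α' = α ∧ F α = α))
    (hβ : (F β < β' ∧ β' < β) ∨ (β' = β ∧ F β = β)) :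
    ∃ Ψ : ℝ ≃o ℝ, (∀ x ∈ Icc α β, Ψ (Ψ x) = F x) ∧ Ψ α = α' ∧ Ψ β = β' := by
  obtain ⟨Φ, hΦ⟩ := exists_orderIso_eqOn_Icc hαβ.le hF hFc
  have hαm : α ∈ Icc α β := left_mem_Icc.2 hαβ.le
  have hβm : β ∈ Icc α β := right_mem_Icc.2 hαβ.le
  have h1 : α ≤ F α := by rcases hα with ⟨h, h'⟩ | ⟨-, h⟩ <;> linarith
  have h2 : F β ≤ β := by rcases hβ with ⟨h, h'⟩ | ⟨-, h⟩ <;> linarith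
  obtain ⟨p, hp, hFp⟩ : ∃ p ∈ Icc α β, F p = p := by
    obtain ⟨p, hp, h⟩ := intermediate_value_Icc' hαβ.le (hFc.sub continuousOn_id)
      (show (0 : ℝ) ∈ Icc (F β - β) (F α - α) by constructor <;> linarith)
    exact ⟨p, hp, sub_eq_zero.1 h⟩
  have hnot : ¬ OrbitRel Φ α β :=
    OrbitRel.not_of_fixed_between ((hΦ p hp).trans hFp) hp.1 hp.2 hαβ
  have hclass : ∀ x ∈ ({α, β} : Set ℝ), ∀ y ∈ ({α, β} : Set ℝ), OrbitRel Φ x y → x = y := by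
    rintro x (hx | hx) y (hy | hy) h <;> rw [hx, hy] at h ⊢
    · exact (hnot h).elim
    · exact (hnot h.symm).elim
  obtain ⟨Ψ, hΨ, hT⟩ := exists_orderIso_sqrt Φ {α, β} (fun x => if x = α then α' else β') hclass <| by
    rintro x (rfl | rfl)
    · simp only [if_true, hΦ x hαm]
      exact hα.elim .inl (.inr ∘ .inr)
    · simp only [if_neg hαβ.ne', hΦ x hβm]
      exact .inr hβ
  refine ⟨Ψ, fun x hx => (hΨ x).trans (hΦ x hx), ?_, ?_⟩
  · simpa using hT α (by simp)
  · simpa [hαβ.ne'] using hT β (by simp)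

/-- Theorem 2.1, first-lap case. -/
theorem stmt0 (a b : ℝ) (F : ℝ → ℝ) (v : ℕ) (c : ℕ → ℝ)
    (hPM : PMFun a b F v c) (hv : 3 ≤ v)
    (hK : Set.MapsTo F (Set.Icc a b) (Set.Icc (c 0) (c 1)))
    (hinc : StrictMonoOn F (Set.Icc (c 0) (c 1)))
    (u : ℕ) (hu4 : 4 ≤ u) (huv : u ≤ v + 1) (huF : F (c u) = c 0)
    (humin : ∀ u' : ℕ, 4 ≤ u' → u' < u → F (c u') ≠ c 0)
    (hmax3 : IsGreatest (F '' Set.Icc (c 0) (c u)) (F (c 3)))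
    (hcond :
      (F (c 2) = c 0 ∧ F (c 0) = c 0 ∧ F (c 1) < F (c 3) ∧ F (c 3) < c 1 ∧
        IsGreatest (F '' Set.Icc a b) (c 1)) ∨
      (c 0 < F (c 2) ∧ F (c 2) < F (c 0) ∧ F (c 3) = c 1 ∧ F (c 1) = c 1) ∨
      (c 0 < F (c 2) ∧ F (c 2) < F (c 0) ∧ F (c 1) < F (c 3) ∧ F (c 3) < c 1)) :
    ∃ f : ℝ → ℝ, ContinuousOn f (Set.Icc a b) ∧
      Set.MapsTo f (Set.Icc a b) (Set.Icc a b) ∧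
      (∀ x ∈ Set.Icc a b, f (f x) = F x) ∧
      StrictMonoOn f (Set.Icc (c 0) (c 1)) ∧
      HeightEq a b f 2 := by
  have h01 : c 0 < c 1 := hPM.c_mono 0 (by omega)
  have h12 : c 1 < c 2 := hPM.c_mono 1 (by omega)
  have h23 : c 2 < c 3 := hPM.c_mono 2 (by omega)
  have h34 : c 3 < c 4 := hPM.c_mono 3 (by omega)
  have h4u : c 4 ≤ c u := hPM.c_le hu4 huv
  have hub : c u ≤ b := hPM.c_last ▸ hPM.c_le huv le_rfl
  have ha : c 0 = a := hPM.c_zero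
  have anti12 : StrictAntiOn F (Icc (c 1) (c 2)) := hPM.anti_of_mono (by omega) hinc
  have mono23 : StrictMonoOn F (Icc (c 2) (c 3)) := hPM.mono_of_anti (by omega) anti12
  have anti34 : StrictAntiOn F (Icc (c 3) (c 4)) := hPM.anti_of_mono (by omega) mono23
  have sub : ∀ {p q}, c 0 ≤ p → q ≤ c u → Icc p q ⊆ Icc a b := fun hp hq =>
    Icc_subset_Icc (ha ▸ hp) (hq.trans hub)
  have hFmax : ∀ x ∈ Icc (c 0) (c u), F x ≤ F (c 3) := fun x hx => hmax3.2 ⟨x, hx, rfl⟩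
  obtain ⟨Ψ, hΨ, hΨ0, hΨ1⟩ := exists_sqrt_Icc_of_endpoints (α' := F (c 2)) (β' := F (c 3)) h01 hinc
    (hPM.cont.mono (sub le_rfl (by linarith)))
    (by rcases hcond with h | h | h <;> [right; left; left] <;> exact ⟨h.1, h.2.1⟩)
    (by
      rcases hcond with ⟨-, -, h, h', -⟩ | ⟨-, -, h, h'⟩ | ⟨-, -, h, h'⟩ <;> [left; right; left] <;>
        exact ⟨h, h'⟩)
  obtain ⟨Λ, hΛ⟩ := exists_orderIso_eqOn_Icc h12.le anti12.neg
    (hPM.cont.mono (sub h01.le (by linarith))).neg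
  obtain ⟨P, hP⟩ := exists_orderIso_eqOn_Icc h23.le mono23
    (hPM.cont.mono (sub (by linarith) (by linarith)))
  -- The root follows `Ψ` on the first lap, and lands in the first, second and third lap of `F`
  -- on `[c 1, c 3]`, `[c 3, c u]` and `[c u, b]` respectively.
  let F' : ℝ → ℝ := IccExtend hPM.lt.le (Icc a b |>.domRestrict F)
  have hF' : ∀ x ∈ Icc a b, F' x = F x := fun x hx => IccExtend_of_mem _ _ hx
  have hF'c : Continuous F' := hPM.cont.domRestrict.Icc_extend'
  let f : ℝ → ℝ := fun x =>
    if x ≤ c 1 then Ψ x else if x ≤ c 3 then Ψ.symm (F' x) else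
      if x ≤ c u then Λ.symm (-Ψ (F' x)) else P.symm (Ψ (F' x))
  have mem : ∀ {x}, c 0 ≤ x → x ≤ c u → x ∈ Icc a b := fun hx hx' =>
    ⟨ha ▸ hx, hx'.trans hub⟩
  have hΨΨ1 : Ψ (F (c 3)) = F (c 1) := by rw [← hΨ1, hΨ _ ⟨h01.le, le_rfl⟩]
  have e1 : Ψ (c 1) = Ψ.symm (F' (c 1)) := by
    rw [hF' _ (mem h01.le (by linarith)), ← hΨ _ ⟨h01.le, le_rfl⟩, Ψ.symm_apply_apply]
  have e3 : Ψ.symm (F' (c 3)) = Λ.symm (-Ψ (F' (c 3))) := by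
    rw [hF' _ (mem (by linarith) (by linarith)), hΨΨ1, ← hΨ1, Ψ.symm_apply_apply,
      ← hΛ _ ⟨le_rfl, h12.le⟩, Λ.symm_apply_apply]
  have eu : Λ.symm (-Ψ (F' (c u))) = P.symm (Ψ (F' (c u))) := by
    rw [hF' _ (mem (by linarith) le_rfl), huF, hΨ0, ← hΛ _ ⟨h12.le, le_rfl⟩,
      Λ.symm_apply_apply, ← hP _ ⟨le_rfl, h23.le⟩, P.symm_apply_apply]
  have hfc : Continuous f := by
    have hΨc := Ψ.continuous
    have hΨc' := Ψ.symm.continuous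
    have hΛc := Λ.symm.continuous
    have hPc := P.symm.continuous
    refine hΨc.if_le (.if_le (by fun_prop) (.if_le (by fun_prop) (by fun_prop) continuous_id
      continuous_const ?_) continuous_id continuous_const ?_) continuous_id continuous_const ?_
    · rintro x rfl
      exact eu
    · rintro x rfl
      rw [if_pos (by linarith)]
      exact e3
    · rintro x rfl
      rw [if_pos (by linarith)]
      exact e1
  have f1 : ∀ x ∈ Icc (c 0) (c 1), f x = Ψ x := fun x hx => if_pos hx.2
  have f2 : ∀ x ∈ Icc (c 1) (c 3), f x = Ψ.symm (F x) := by
    intro x hx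
    rw [← hF' x (mem (by linarith [hx.1]) (by linarith [hx.2]))]
    rcases hx.1.eq_or_lt with rfl | h
    · exact (if_pos le_rfl).trans e1
    · simp only [f]
      rw [if_neg h.not_ge, if_pos hx.2]
  have f3 : ∀ x ∈ Icc (c 3) (c u), f x = Λ.symm (-Ψ (F x)) := by
    intro x hx
    rcases hx.1.eq_or_lt with rfl | h
    · rw [f2 _ ⟨by linarith, le_rfl⟩, ← hF' _ (mem (by linarith) (by linarith)), e3]
    · simp only [f]
      rw [if_neg (by linarith), if_neg h.not_ge, if_pos hx.2,
        hF' x (mem (by linarith) hx.2)]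
  have f4 : ∀ x, c u < x → x ≤ b → f x = P.symm (Ψ (F x)) := by
    intro x h hx
    simp only [f]
    rw [if_neg (by linarith), if_neg (by linarith), if_neg h.not_ge,
      hF' x ⟨by linarith, hx⟩]
  have mapsΨ : ∀ x ∈ Icc (c 0) (c 1), Ψ x ∈ Icc (F (c 2)) (F (c 3)) := fun x hx =>
    ⟨hΨ0 ▸ Ψ.monotone hx.1, hΨ1 ▸ Ψ.monotone hx.2⟩
  have maps1 : ∀ x ∈ Icc (c 0) (c 1), f x ∈ Icc (c 0) (c 1) := by
    intro x hx
    rw [f1 x hx]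
    have h2 := hK (mem (x := c 2) (by linarith) (by linarith))
    have h3 := hK (mem (x := c 3) (by linarith) (by linarith))
    exact ⟨h2.1.trans (mapsΨ x hx).1, (mapsΨ x hx).2.trans h3.2⟩
  have maps2 : ∀ x ∈ Icc (c 1) (c 3), Ψ.symm (F x) ∈ Icc (c 0) (c 1) := by
    intro x hx
    rw [mem_Icc, Ψ.le_symm_apply, Ψ.symm_apply_le, hΨ0, hΨ1]
    refine ⟨?_, hFmax x ⟨by linarith [hx.1], by linarith [hx.2]⟩⟩
    rcases le_total x (c 2) with h | h
    · exact anti12.antitoneOn ⟨hx.1, h⟩ ⟨h12.le, le_rfl⟩ h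
    · exact mono23.monotoneOn ⟨le_rfl, h23.le⟩ ⟨h, hx.2⟩ h
  have maps3 : ∀ x ∈ Icc (c 3) (c u), Λ.symm (-Ψ (F x)) ∈ Icc (c 1) (c 2) := by
    intro x hx
    have hx0 : c 0 ≤ x := by linarith [hx.1]
    rw [mem_Icc, Λ.le_symm_apply, Λ.symm_apply_le, hΛ _ ⟨le_rfl, h12.le⟩, hΛ _ ⟨h12.le, le_rfl⟩,
      neg_le_neg_iff, neg_le_neg_iff, ← hΨΨ1]
    exact ⟨Ψ.monotone (hFmax x ⟨hx0, hx.2⟩), (mapsΨ _ (hK (mem hx0 hx.2))).1⟩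
  have maps4 : ∀ x ∈ Icc a b, P.symm (Ψ (F x)) ∈ Icc (c 2) (c 3) := by
    intro x hx
    rw [mem_Icc, P.le_symm_apply, P.symm_apply_le, hP _ ⟨le_rfl, h23.le⟩, hP _ ⟨h23.le, le_rfl⟩]
    exact mapsΨ _ (hK hx)
  have cover : ∀ x ∈ Icc a b, x ∈ Icc (c 0) (c 1) ∨ x ∈ Icc (c 1) (c 3) ∨ x ∈ Icc (c 3) (c u) ∨
      c u < x := by
    intro x hx
    rw [← ha] at hx
    rcases le_total x (c 1) with h | h
    · exact .inl ⟨hx.1, h⟩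
    rcases le_total x (c 3) with h' | h'
    · exact .inr (.inl ⟨h, h'⟩)
    rcases le_or_gt x (c u) with h'' | h''
    · exact .inr (.inr (.inl ⟨h', h''⟩))
    · exact .inr (.inr (.inr h''))
  have hmaps : MapsTo f (Icc a b) (Icc a b) := by
    intro x hx
    rcases cover x hx with h | h | h | h
    · exact sub le_rfl (by linarith) (maps1 x h)
    · rw [f2 x h]
      exact sub le_rfl (by linarith) (maps2 x h)
    · rw [f3 x h]
      exact sub h01.le (by linarith) (maps3 x h)
    · rw [f4 x h hx.2]
      exact sub (by linarith) (by linarith) (maps4 x hx)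
  have hsq : ∀ x ∈ Icc a b, f (f x) = F x := by
    intro x hx
    rcases cover x hx with h | h | h | h
    · rw [f1 _ (maps1 x h), f1 x h, hΨ x h]
    · rw [f2 x h, f1 _ (maps2 x h), Ψ.apply_symm_apply]
    · have hm := maps3 x h
      have hF := hΛ _ hm
      rw [Λ.apply_symm_apply, neg_inj] at hF
      rw [f3 x h, f2 _ ⟨hm.1, hm.2.trans h23.le⟩, ← hF, Ψ.symm_apply_apply]
    · have hm := maps4 x hx
      rw [f4 x h hx.2, f2 _ ⟨h12.le.trans hm.1, hm.2⟩, ← hP _ hm, P.apply_symm_apply,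
        Ψ.symm_apply_apply]
  have hmono : StrictMonoOn f (Icc (c 0) (c 1)) := fun x hx y hy hxy => by
    rw [f1 x hx, f1 y hy]
    exact Ψ.strictMono hxy
  refine ⟨f, hfc.continuousOn, hmaps, hsq, hmono, ?_⟩
  refine heightEq_two_of_sq hfc.continuousOn hsq hPM.finite_forts hK hmono
    ⟨c 1, isFort_of_mono_anti ha.ge h01 h12 (by linarith) hmono fun x hx y hy hxy => ?_⟩
    ⟨c 3, hPM.fort 3 (by omega) hv, not_isFort_of_Icc h23 h34 (.inl ?_)⟩
  · rw [f2 x ⟨hx.1, hx.2.trans h23.le⟩, f2 y ⟨hy.1, hy.2.trans h23.le⟩]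
    exact Ψ.symm.strictMono (anti12 hx hy hxy)
  · rw [← Icc_union_Icc_eq_Icc h23.le h34.le]
    refine StrictMonoOn.union (fun x hx y hy hxy => ?_) (fun x hx y hy hxy => ?_)
      (isGreatest_Icc h23.le) (isLeast_Icc h34.le)
    · rw [f2 x ⟨h12.le.trans hx.1, hx.2⟩, f2 y ⟨h12.le.trans hy.1, hy.2⟩]
      exact Ψ.symm.strictMono (mono23 hx hy hxy)
    · rw [f3 x ⟨hx.1, hx.2.trans h4u⟩, f3 y ⟨hy.1, hy.2.trans h4u⟩]
      exact Λ.symm.strictMono (neg_lt_neg (Ψ.strictMono (anti34 hx hy hxy)))
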